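/- There exist a constant C > 0, depending only on n, γ, μ, σ, K, R0 and c3 (in particular independent of ε and u), a C¹ vector field F : B_{R0} → ℝ^{n−1}, and a continuous function G : B_{R0} → ℝ, such that for all y' ∈ B_{R0}: (i) (ε + μ|y'|²) Δv̄(y') + 2μ ⟨y', ∇v̄(y')⟩ − (2/γ) v̄(y') = div F(y') + G(y'); (ii) |F(y')| ≤ C ( ε|y'| · (1/(2ε)) ∫_{−ε}^{ε} |∂_{y_n} v(y', y_n)| dy_n + |f(y') − g(y') − μ|y'|²| · |∇v̄(y')| ); and (iii) |G(y')| ≤ C ( ε · max_{|y_n| ≤ ε} |∂_{y_n} v(y', y_n)| + |y'|² |v̄(y')| ). -/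

import Mathlib

open MeasureTheory Metric Set
open scoped RealInnerProductSpace ENNReal

noncomputable section

/-- `n`-dimensional Euclidean space. -/
abbrev E (k : ℕ) := EuclideanSpace ℝ (Fin k)

/-- Laplacian: sum of pure second directional derivatives. -/
def elap {k : ℕ} (u : E k → ℝ) (x : E k) : ℝ :=
  ∑ i : Fin k, iteratedFDeriv ℝ 2 u x ![EuclideanSpace.single i 1, EuclideanSpace.single i 1]

/-- The horizontal part `x'` of `x = (x', x_n)`. -/
def epre {m : ℕ} (x : E (m+1)) : E m :=
  (EuclideanSpace.equiv (Fin m) ℝ).symm fun i => x i.castSucc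

/-- The vertical (last) coordinate `x_n` of `x = (x', x_n)`. -/
def lastC {m : ℕ} (x : E (m+1)) : ℝ := x (Fin.last m)

/-- Assemble the point `(p, t)`. -/
def eglue {m : ℕ} (p : E m) (t : ℝ) : E (m+1) :=
  (EuclideanSpace.equiv (Fin (m+1)) ℝ).symm fun i => Fin.lastCases t (fun j => p j) i

/-- The narrow region `Ω_{x0',r}`. -/
def neck {m : ℕ} (ε : ℝ) (f g : E m → ℝ) (x0 : E m) (r : ℝ) : Set (E (m+1)) :=
  {x | ‖epre x - x0‖ < r ∧ -(ε/2) + g (epre x) < lastC x ∧ lastC x < ε/2 + f (epre x)}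

/-- The upper boundary `Γ₊`. -/
def gammaP {m : ℕ} (ε R0 : ℝ) (f : E m → ℝ) : Set (E (m+1)) :=
  (fun p => eglue p (ε/2 + f p)) '' ball (0 : E m) R0

/-- The lower boundary `Γ₋`. -/
def gammaM {m : ℕ} (ε R0 : ℝ) (g : E m → ℝ) : Set (E (m+1)) :=
  (fun p => eglue p (-(ε/2) + g p)) '' ball (0 : E m) R0

/-- The unit normal on `Γ₊` (pointing upward). -/
def nuP {m : ℕ} (f : E m → ℝ) (p : E m) : E (m+1) :=
  (Real.sqrt (1 + ‖gradient f p‖^2))⁻¹ • eglue (-(gradient f p)) 1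

/-- The unit normal on `Γ₋` (pointing downward). -/
def nuM {m : ℕ} (g : E m → ℝ) (p : E m) : E (m+1) :=
  (Real.sqrt (1 + ‖gradient g p‖^2))⁻¹ • eglue (gradient g p) (-1)

/-- The region `Ω_{R0} ∪ Γ₊ ∪ Γ₋`. -/
def regio {m : ℕ} (ε R0 : ℝ) (f g : E m → ℝ) : Set (E (m+1)) :=
  neck ε f g 0 R0 ∪ gammaP ε R0 f ∪ gammaM ε R0 g

/-- `u` is a solution of the local Robin problem with constants `U1`, `U2`:
`u` is C¹ on `Ω_{R0} ∪ Γ₊ ∪ Γ₋`, harmonic in `Ω_{R0}`, and satisfies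
`u + γ ∂_ν u = U1` on `Γ₊` and `u + γ ∂_ν u = U2` on `Γ₋`. -/
def IsLocalSol {m : ℕ} (ε R0 γ : ℝ) (f g : E m → ℝ) (u : E (m+1) → ℝ) (U1 U2 : ℝ) : Prop :=
  (∀ x ∈ regio ε R0 f g, DifferentiableAt ℝ u x) ∧
  ContinuousOn (fun x => gradient u x) (regio ε R0 f g) ∧
  ContDiffOn ℝ 2 u (neck ε f g 0 R0) ∧
  (∀ x ∈ neck ε f g 0 R0, elap u x = 0) ∧
  (∀ p ∈ ball (0 : E m) R0,
    u (eglue p (ε/2 + f p)) + γ * ⟪nuP f p, gradient u (eglue p (ε/2 + f p))⟫ = U1) ∧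
  (∀ p ∈ ball (0 : E m) R0,
    u (eglue p (-(ε/2) + g p)) + γ * ⟪nuM g p, gradient u (eglue p (-(ε/2) + g p))⟫ = U2)

/-- `f` is C^{1,1} with C^{1,1} norm at most `c`. -/
def C11 {k : ℕ} (c : ℝ) (f : E k → ℝ) : Prop :=
  Differentiable ℝ f ∧ (∀ p, |f p| ≤ c) ∧ (∀ p, ‖gradient f p‖ ≤ c) ∧
    LipschitzWith c.toNNReal (fun p => gradient f p)

/-- The standing hypotheses on `f`, `g`:  C^{1,1} norms at most `c2`,
`f(0)=g(0)=0`, `∇f(0)=∇g(0)=0`, and `c1 |x'|² ≤ f - g` on `|x'| < R0`. -/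
def FGSetting {m : ℕ} (R0 c1 c2 : ℝ) (f g : E m → ℝ) : Prop :=
  C11 c2 f ∧ C11 c2 g ∧ f 0 = 0 ∧ g 0 = 0 ∧ gradient f 0 = 0 ∧ gradient g 0 = 0 ∧
    ∀ p : E m, ‖p‖ < R0 → c1 * ‖p‖^2 ≤ f p - g p

/-- `f` is C^{2,σ} with C^{2,σ} norm at most `c`. -/
def C2Sigma {k : ℕ} (c σ : ℝ) (f : E k → ℝ) : Prop :=
  ContDiff ℝ 2 f ∧ (∀ p, |f p| ≤ c) ∧ (∀ p, ‖gradient f p‖ ≤ c) ∧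
    (∀ p, ‖fderiv ℝ (fun q => gradient f q) p‖ ≤ c) ∧
    (∀ p q, ‖fderiv ℝ (fun q => gradient f q) p - fderiv ℝ (fun q => gradient f q) q‖
        ≤ c * ‖p - q‖ ^ σ)

/-- Divergence of a vector field on `ℝ^m`. -/
def divg {m : ℕ} (F : E m → E m) (y : E m) : ℝ :=
  ∑ i : Fin m, (fderiv ℝ F y (EuclideanSpace.single i 1)) i

/-- The flattened function `v(y', y_n) := u(y', g(y') - ε/2 + (y_n+ε)(ε+f(y')-g(y'))/(2ε))`. -/
def flatV {m : ℕ} (ε : ℝ) (f g : E m → ℝ) (u : E (m+1) → ℝ) (p : E m) (t : ℝ) : ℝ :=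
  u (eglue p (g p - ε/2 + (t + ε) * (ε + f p - g p) / (2*ε)))

/-- The vertical average `v̄(y') := (1/(2ε)) ∫_{-ε}^{ε} v(y', y_n) dy_n`. -/
def vbar {m : ℕ} (ε : ℝ) (f g : E m → ℝ) (u : E (m+1) → ℝ) (p : E m) : ℝ :=
  (1/(2*ε)) * ∫ t in (-ε)..ε, flatV ε f g u p t

theorem exists_nhds_bound_of_continuousAt {P H : Type*} [PseudoMetricSpace P] [ProperSpace P]
    [SeminormedAddCommGroup H] {V : Set P} {a b : ℝ} {φ : P × ℝ → H} (hV : IsOpen V)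
    (hφ : ∀ p ∈ V, ∀ t ∈ Icc a b, ContinuousAt φ (p, t)) {p : P} (hp : p ∈ V) :
    ∃ s ∈ nhds p, s ⊆ V ∧ ∃ C : ℝ, ∀ q ∈ s, ∀ t ∈ Icc a b, ‖φ (q, t)‖ ≤ C := by
  obtain ⟨r, hr, hrV⟩ := Metric.nhds_basis_closedBall.mem_iff.1 (hV.mem_nhds hp)
  have hc : IsCompact (closedBall p r ×ˢ Icc a b) :=
    (isCompact_closedBall p r).prod isCompact_Icc
  obtain ⟨C, hC⟩ := hc.exists_bound_of_continuousOn (f := φ)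
    fun x hx => (hφ x.1 (hrV hx.1) x.2 hx.2).continuousWithinAt
  exact ⟨_, closedBall_mem_nhds p hr, hrV, C, fun q hq t ht => hC (q, t) ⟨hq, ht⟩⟩

theorem continuousOn_slice {P H : Type*} [TopologicalSpace P] [TopologicalSpace H]
    {V : Set P} {a b : ℝ} {φ : P × ℝ → H} (hφ : ∀ p ∈ V, ∀ t ∈ Icc a b, ContinuousAt φ (p, t))
    {p : P} (hp : p ∈ V) : ContinuousOn (fun t => φ (p, t)) (Icc a b) := fun t ht =>
  (ContinuousAt.comp (f := fun t => (p, t)) (hφ p hp t ht)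
    (by fun_prop)).continuousWithinAt

section ParametricIntegral
variable {P H : Type*} [NormedAddCommGroup P] [NormedSpace ℝ P] [ProperSpace P]
  [NormedAddCommGroup H] [NormedSpace ℝ H] {V : Set P} {a b : ℝ} {φ : P × ℝ → H}

theorem continuousOn_parametric_intervalIntegral (hab : a ≤ b) (hV : IsOpen V)
    (hφ : ∀ p ∈ V, ∀ t ∈ Icc a b, ContinuousAt φ (p, t)) :
    ContinuousOn (fun p => ∫ t in a..b, φ (p, t)) V := by
  intro p hp
  obtain ⟨s, hs, hsV, C, hC⟩ := exists_nhds_bound_of_continuousAt hV hφ hp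
  refine (intervalIntegral.continuousAt_of_dominated_interval (bound := fun _ => C)
    ?_ ?_ intervalIntegrable_const ?_).continuousWithinAt
  · filter_upwards [hs] with q hq
    rw [uIoc_of_le hab]
    exact ((continuousOn_slice hφ (hsV hq)).mono Ioc_subset_Icc_self).aestronglyMeasurable
      measurableSet_Ioc
  · filter_upwards [hs] with q hq
    refine .of_forall fun t ht => hC q hq t ?_
    rw [uIoc_of_le hab] at ht
    exact Ioc_subset_Icc_self ht
  · refine .of_forall fun t ht => ?_
    rw [uIoc_of_le hab] at ht
    exact ContinuousAt.comp (f := fun q => (q, t)) (hφ p hp t (Ioc_subset_Icc_self ht))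
      (by fun_prop)

theorem hasFDerivAt_parametric_intervalIntegral (hab : a ≤ b) (hV : IsOpen V)
    (hφ : ∀ p ∈ V, ∀ t ∈ Icc a b, ContDiffAt ℝ 1 φ (p, t)) {p : P} (hp : p ∈ V) :
    HasFDerivAt (fun p => ∫ t in a..b, φ (p, t))
      (∫ t in a..b, (fderiv ℝ φ (p, t)).comp (ContinuousLinearMap.inl ℝ P ℝ)) p := by
  have hφc : ∀ p ∈ V, ∀ t ∈ Icc a b, ContinuousAt φ (p, t) :=
    fun p hp t ht => (hφ p hp t ht).continuousAt
  have hφ' : ∀ p ∈ V, ∀ t ∈ Icc a b, ContinuousAt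
      (fun x => (fderiv ℝ φ x).comp (ContinuousLinearMap.inl ℝ P ℝ)) (p, t) := fun p hp t ht =>
    (((hφ p hp t ht).fderiv_right (m := 0) (by norm_num)).continuousAt).clm_comp
      continuousAt_const
  obtain ⟨s, hs, hsV, C, hC⟩ := exists_nhds_bound_of_continuousAt hV hφ' hp
  refine intervalIntegral.hasFDerivAt_integral_of_dominated_of_fderiv_le (𝕜 := ℝ)
    (F' := fun p t => (fderiv ℝ φ (p, t)).comp (ContinuousLinearMap.inl ℝ P ℝ)) hs
    (bound := fun _ => C) ?_ ?_ ?_ ?_ intervalIntegrable_const ?_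
  · filter_upwards [hs] with q hq
    rw [uIoc_of_le hab]
    exact ((continuousOn_slice hφc (hsV hq)).mono Ioc_subset_Icc_self).aestronglyMeasurable
      measurableSet_Ioc
  · exact ContinuousOn.intervalIntegrable_of_Icc hab (continuousOn_slice hφc hp)
  · rw [uIoc_of_le hab]
    exact ((continuousOn_slice hφ' hp).mono Ioc_subset_Icc_self).aestronglyMeasurable
      measurableSet_Ioc
  · refine .of_forall fun t ht q hq => hC q hq t ?_
    rw [uIoc_of_le hab] at ht
    exact Ioc_subset_Icc_self ht
  · refine .of_forall fun t ht q hq => ?_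
    rw [uIoc_of_le hab] at ht
    exact HasFDerivAt.comp (f := fun q => (q, t)) q
      ((hφ q (hsV hq) t (Ioc_subset_Icc_self ht)).differentiableAt (by norm_num)).hasFDerivAt
      (hasFDerivAt_prodMk_left q t)

theorem contDiffOn_one_parametric_intervalIntegral (hab : a ≤ b) (hV : IsOpen V)
    (hφ : ∀ p ∈ V, ∀ t ∈ Icc a b, ContDiffAt ℝ 1 φ (p, t)) :
    ContDiffOn ℝ 1 (fun p => ∫ t in a..b, φ (p, t)) V := by
  have hd := fun p hp => hasFDerivAt_parametric_intervalIntegral hab hV hφ (p := p) hp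
  rw [show (1 : WithTop ℕ∞) = 0 + 1 by norm_num, contDiffOn_succ_iff_fderiv_of_isOpen hV]
  refine ⟨fun p hp => (hd p hp).differentiableAt.differentiableWithinAt, by simp, ?_⟩
  rw [contDiffOn_zero]
  refine ContinuousOn.congr (continuousOn_parametric_intervalIntegral hab hV
    (φ := fun x => (fderiv ℝ φ x).comp (ContinuousLinearMap.inl ℝ P ℝ)) fun p hp t ht => ?_)
    fun p hp => (hd p hp).fderiv
  exact (((hφ p hp t ht).fderiv_right (m := 0) (by norm_num)).continuousAt).clm_comp
    continuousAt_const

theorem hasFDerivAt_intervalIntegral_of_slice (hab : a ≤ b) (hV : IsOpen V)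
    (hφ : ∀ p ∈ V, ∀ t ∈ Icc a b, ContDiffAt ℝ 1 φ (p, t)) {p : P} (hp : p ∈ V)
    {A : ℝ → P →L[ℝ] H} (hA : ∀ t ∈ Icc a b, HasFDerivAt (fun q => φ (q, t)) (A t) p) :
    ContinuousOn A (Icc a b) ∧
      HasFDerivAt (fun p => ∫ t in a..b, φ (p, t)) (∫ t in a..b, A t) p := by
  have hEq : ∀ t ∈ Icc a b,
      A t = (fderiv ℝ φ (p, t)).comp (ContinuousLinearMap.inl ℝ P ℝ) := fun t ht =>
    (hA t ht).unique (HasFDerivAt.comp (f := fun q => (q, t)) p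
      ((hφ p hp t ht).differentiableAt (by norm_num)).hasFDerivAt (hasFDerivAt_prodMk_left p t))
  constructor
  · refine (continuousOn_slice (V := V)
      (φ := fun x => (fderiv ℝ φ x).comp (ContinuousLinearMap.inl ℝ P ℝ))
      (fun p hp t ht => ?_) hp).congr hEq
    exact (((hφ p hp t ht).fderiv_right (m := 0) (by norm_num)).continuousAt).clm_comp
      continuousAt_const
  · rw [intervalIntegral.integral_congr (g := fun t =>
      (fderiv ℝ φ (p, t)).comp (ContinuousLinearMap.inl ℝ P ℝ))
      fun t ht => hEq t (by rwa [uIcc_of_le hab] at ht)]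
    exact hasFDerivAt_parametric_intervalIntegral hab hV hφ hp

end ParametricIntegral

/-- The embedding `p ↦ (p, 0)`. -/
def horizL (m : ℕ) : E m →L[ℝ] E (m+1) :=
  ∑ i : Fin m, (EuclideanSpace.proj i : E m →L[ℝ] ℝ).smulRight (EuclideanSpace.single i.castSucc 1)

/-- The vertical unit vector. -/
def vertE (m : ℕ) : E (m+1) := EuclideanSpace.single (Fin.last m) 1

/-- The vector representing the pullback of a linear form along `T`. -/
def dualComp {m : ℕ} {X : Type*} [NormedAddCommGroup X] [NormedSpace ℝ X] (T : E m →L[ℝ] X) :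
    (X →L[ℝ] ℝ) →L[ℝ] E m :=
  ∑ i : Fin m, (ContinuousLinearMap.apply ℝ ℝ (T (EuclideanSpace.single i 1))).smulRight
    (EuclideanSpace.single i (1:ℝ) : E m)

/-- The trace of an endomorphism, as a continuous linear form. -/
def traceL (m : ℕ) : (E m →L[ℝ] E m) →L[ℝ] ℝ :=
  ∑ i : Fin m, (EuclideanSpace.proj i : E m →L[ℝ] ℝ).comp
    (ContinuousLinearMap.apply ℝ (E m) (EuclideanSpace.single i (1:ℝ) : E m))

theorem horizL_single {m : ℕ} (i : Fin m) :
    horizL m (EuclideanSpace.single i 1) = EuclideanSpace.single i.castSucc 1 := by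
  simp [horizL]

theorem eglue_eq {m : ℕ} (p : E m) (t : ℝ) : eglue p t = horizL m p + t • vertE m := by
  ext j
  refine Fin.lastCases ?_ (fun i => ?_) j
  · simp [eglue, horizL, vertE, (Fin.castSucc_lt_last _).ne']
  · simp [eglue, horizL, vertE, Pi.single_apply,
      (Fin.castSucc_lt_last _).ne]

theorem epre_eglue {m : ℕ} (p : E m) (t : ℝ) : epre (eglue p t) = p := by
  ext i; simp [epre, eglue]

theorem lastC_eglue {m : ℕ} (p : E m) (t : ℝ) : lastC (eglue p t) = t := by
  simp [lastC, eglue]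

theorem sum_smul_single {m : ℕ} (p : E m) :
    ∑ i, p i • (EuclideanSpace.single i (1:ℝ) : E m) = p := by
  ext j; simp [Pi.single_apply]

theorem sum_mul_apply_single {m : ℕ} (ℓ : E m →L[ℝ] ℝ) (p : E m) :
    ∑ i, p i * ℓ (EuclideanSpace.single i 1) = ℓ p := by
  conv_rhs => rw [← sum_smul_single p]
  simp

section DualComp
variable {m : ℕ} {X : Type*} [NormedAddCommGroup X] [NormedSpace ℝ X] (T : E m →L[ℝ] X)

theorem dualComp_coord (ℓ : X →L[ℝ] ℝ) (i : Fin m) :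
    dualComp T ℓ i = ℓ (T (EuclideanSpace.single i 1)) := by
  simp [dualComp, Pi.single_apply]

theorem inner_dualComp (ℓ : X →L[ℝ] ℝ) (p : E m) : ⟪dualComp T ℓ, p⟫ = ℓ (T p) := by
  rw [← ContinuousLinearMap.comp_apply, ← sum_mul_apply_single (ℓ.comp T) p,
    PiLp.inner_apply]
  simp [dualComp_coord]
end DualComp

theorem gradient_eq_dualComp {m : ℕ} (f : E m → ℝ) :
    gradient f = fun p => dualComp (ContinuousLinearMap.id ℝ (E m)) (fderiv ℝ f p) := by
  funext p
  refine ext_inner_right ℝ fun a => ?_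
  rw [inner_dualComp]
  simp [gradient]

theorem inner_gradient_eq_fderiv {k : ℕ} (f : E k → ℝ) (p a : E k) :
    ⟪gradient f p, a⟫ = fderiv ℝ f p a := by
  simp [gradient]

theorem gradient_coord {k : ℕ} (f : E k → ℝ) (p : E k) (i : Fin k) :
    gradient f p i = fderiv ℝ f p (EuclideanSpace.single i 1) := by
  rw [gradient_eq_dualComp, dualComp_coord]; rfl

theorem traceL_apply {m : ℕ} (A : E m →L[ℝ] E m) :
    traceL m A = ∑ i, A (EuclideanSpace.single i 1) i := by
  simp [traceL]

theorem divg_eq_traceL {m : ℕ} (F : E m → E m) (y : E m) :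
    divg F y = traceL m (fderiv ℝ F y) := (traceL_apply _).symm

theorem traceL_smulRight {m : ℕ} (ℓ : E m →L[ℝ] ℝ) (p : E m) :
    traceL m (ℓ.smulRight p) = ℓ p := by
  rw [traceL_apply, ← sum_mul_apply_single ℓ p]
  simp [mul_comm]

theorem elap_eq {k : ℕ} (u : E k → ℝ) (x : E k) :
    elap u x = ∑ i : Fin k, fderiv ℝ (fderiv ℝ u) x (EuclideanSpace.single i 1)
      (EuclideanSpace.single i 1) := by
  simp [elap, iteratedFDeriv_two_apply]

theorem elap_succ_eq {m : ℕ} (u : E (m+1) → ℝ) (x : E (m+1)) :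
    elap u x = ∑ i : Fin m, fderiv ℝ (fderiv ℝ u) x (horizL m (EuclideanSpace.single i 1))
      (horizL m (EuclideanSpace.single i 1)) + fderiv ℝ (fderiv ℝ u) x (vertE m) (vertE m) := by
  rw [elap_eq, Fin.sum_univ_castSucc]
  simp only [horizL_single, vertE]

theorem contDiffAt_gradient {k : ℕ} {f : E k → ℝ} {p : E k} (hf : ContDiffAt ℝ 2 f p) :
    ContDiffAt ℝ 1 (gradient f) p := by
  rw [gradient_eq_dualComp]
  exact (ContinuousLinearMap.contDiff _).contDiffAt.comp p (hf.fderiv_right (by norm_num))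

theorem divg_gradient {m : ℕ} {w : E m → ℝ} {y : E m} (hw : ContDiffAt ℝ 2 w y) :
    divg (gradient w) y = elap w y := by
  have h1 : DifferentiableAt ℝ (fderiv ℝ w) y :=
    (hw.fderiv_right (m := 1) (by norm_num)).differentiableAt (by norm_num)
  rw [elap_eq, divg, gradient_eq_dualComp]
  have h2 := ((dualComp (ContinuousLinearMap.id ℝ (E m))).hasFDerivAt.comp y
    h1.hasFDerivAt).fderiv
  simp only [Function.comp_def] at h2
  simp [h2, dualComp_coord]

theorem divg_smul {m : ℕ} {s : E m → ℝ} {A : E m → E m} {y : E m}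
    (hs : DifferentiableAt ℝ s y) (hA : DifferentiableAt ℝ A y) :
    divg (fun y => s y • A y) y = s y * divg A y + fderiv ℝ s y (A y) := by
  rw [divg_eq_traceL, divg_eq_traceL, fderiv_fun_smul hs hA, map_add, map_smul,
    traceL_smulRight, smul_eq_mul]

theorem divg_sub {m : ℕ} {A B : E m → E m} {y : E m}
    (hA : DifferentiableAt ℝ A y) (hB : DifferentiableAt ℝ B y) :
    divg (fun y => A y - B y) y = divg A y - divg B y := by
  simp only [divg_eq_traceL]
  rw [fderiv_fun_sub hA hB, map_sub]

/-- The vertical coordinate of the flattening map. -/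
def flatX {m : ℕ} (ε : ℝ) (f g : E m → ℝ) (x : E m × ℝ) : ℝ :=
  g x.1 - ε/2 + (x.2 + ε) * (ε + f x.1 - g x.1) / (2*ε)

/-- The flattening map. -/
def flatMap {m : ℕ} (ε : ℝ) (f g : E m → ℝ) (x : E m × ℝ) : E (m+1) :=
  horizL m x.1 + flatX ε f g x • vertE m

/-- The horizontal gradient of `flatX`. -/
def flatGrad {m : ℕ} (ε : ℝ) (f g : E m → ℝ) (p : E m) (t : ℝ) : E m :=
  gradient g p + ((t + ε) / (2*ε)) • (gradient f p - gradient g p)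

/-- The horizontal flux of `u` through vertical slices. -/
def sliceFlux {m : ℕ} (ε : ℝ) (f g : E m → ℝ) (u : E (m+1) → ℝ) (p : E m) : E m :=
  ∫ t in (-ε)..ε, ((ε + f p - g p) / (2*ε)) •
    dualComp (horizL m) (fderiv ℝ u (flatMap ε f g (p, t)))

theorem flatV_eq {m : ℕ} (ε : ℝ) (f g : E m → ℝ) (u : E (m+1) → ℝ) (p : E m) (t : ℝ) :
    flatV ε f g u p t = u (flatMap ε f g (p, t)) := by
  simp [flatV, flatMap, flatX, eglue_eq]

theorem flatMap_eq_eglue {m : ℕ} (ε : ℝ) (f g : E m → ℝ) (x : E m × ℝ) :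
    flatMap ε f g x = eglue x.1 (flatX ε f g x) := by
  simp [flatMap, eglue_eq]

theorem flatX_top {m : ℕ} {ε : ℝ} (hε : 0 < ε) (f g : E m → ℝ) (p : E m) :
    flatX ε f g (p, ε) = ε/2 + f p := by
  simp only [flatX]; field_simp; ring

theorem flatX_bot {m : ℕ} (ε : ℝ) (f g : E m → ℝ) (p : E m) :
    flatX ε f g (p, -ε) = -(ε/2) + g p := by
  simp only [flatX]; ring

theorem flatGrad_top {m : ℕ} {ε : ℝ} (hε : 0 < ε) (f g : E m → ℝ) (p : E m) :
    flatGrad ε f g p ε = gradient f p := by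
  have : (ε + ε) / (2*ε) = 1 := by field_simp; ring
  simp [flatGrad, this]

theorem flatGrad_bot {m : ℕ} (ε : ℝ) (f g : E m → ℝ) (p : E m) :
    flatGrad ε f g p (-ε) = gradient g p := by
  simp [flatGrad]

theorem flatMap_mem_neck {m : ℕ} {ε R0 : ℝ} (hε : 0 < ε) {f g : E m → ℝ} {p : E m} {t : ℝ}
    (hp : p ∈ ball (0 : E m) R0) (hfg : 0 ≤ f p - g p) (ht : t ∈ Ioo (-ε) ε) :
    flatMap ε f g (p, t) ∈ neck ε f g 0 R0 := by
  rw [flatMap_eq_eglue]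
  simp only [neck, mem_ofPred_eq, epre_eglue, lastC_eglue, sub_zero]
  have hh : 0 < ε + f p - g p := by linarith
  refine ⟨mem_ball_zero_iff.1 hp, ?_, ?_⟩
  · have : 0 < (t + ε) * (ε + f p - g p) / (2*ε) :=
      div_pos (mul_pos (by linarith [ht.1]) hh) (by linarith)
    simp only [flatX]; linarith
  · have : (t + ε) * (ε + f p - g p) / (2*ε) < ε + f p - g p := by
      rw [div_lt_iff₀ (by linarith)]; nlinarith [ht.2]
    simp only [flatX]; linarith

theorem flatMap_mem_regio {m : ℕ} {ε R0 : ℝ} (hε : 0 < ε) {f g : E m → ℝ} {p : E m} {t : ℝ}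
    (hp : p ∈ ball (0 : E m) R0) (hfg : 0 ≤ f p - g p) (ht : t ∈ Icc (-ε) ε) :
    flatMap ε f g (p, t) ∈ regio ε R0 f g := by
  rcases eq_or_lt_of_le ht.1 with h1 | h1
  · right
    exact ⟨p, hp, by rw [← h1, flatMap_eq_eglue, flatX_bot]⟩
  rcases eq_or_lt_of_le ht.2 with h2 | h2
  · left; right
    exact ⟨p, hp, by rw [h2, flatMap_eq_eglue, flatX_top hε]⟩
  · exact .inl (.inl (flatMap_mem_neck hε hp hfg ⟨h1, h2⟩))

theorem contDiff_flatMap {m : ℕ} {ε : ℝ} {f g : E m → ℝ} (hf : ContDiff ℝ 2 f)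
    (hg : ContDiff ℝ 2 g) : ContDiff ℝ 2 (flatMap ε f g) := by
  unfold flatMap flatX
  fun_prop

theorem hasFDerivAt_flatX {m : ℕ} {ε : ℝ} {f g : E m → ℝ} (hf : ContDiff ℝ 2 f)
    (hg : ContDiff ℝ 2 g) (p : E m) (t : ℝ) :
    HasFDerivAt (fun q => flatX ε f g (q, t)) (innerSL ℝ (flatGrad ε f g p t)) p := by
  have h1 := ((hf.differentiable (by norm_num)) p).hasFDerivAt
  have h2 := ((hg.differentiable (by norm_num)) p).hasFDerivAt
  have h := (h2.sub_const (ε/2)).add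
    ((((h1.const_add ε).sub h2).const_mul (t + ε)).mul_const (2*ε)⁻¹)
  refine h.congr_fderiv ?_
  ext a
  simp only [flatGrad, innerSL_apply_apply, inner_add_left, inner_smul_left, inner_sub_left,
    inner_gradient_eq_fderiv]
  simp
  ring

theorem hasDerivAt_flatX {m : ℕ} (ε : ℝ) (f g : E m → ℝ) (p : E m) (t : ℝ) :
    HasDerivAt (fun t => flatX ε f g (p, t)) ((ε + f p - g p) / (2*ε)) t := by
  have := ((((hasDerivAt_id t).add_const ε).mul_const (ε + f p - g p)).div_const
    (2*ε)).const_add (g p - ε/2)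
  simpa [flatX] using this

theorem hasFDerivAt_flatMap {m : ℕ} {ε : ℝ} {f g : E m → ℝ} (hf : ContDiff ℝ 2 f)
    (hg : ContDiff ℝ 2 g) (p : E m) (t : ℝ) :
    HasFDerivAt (fun q => flatMap ε f g (q, t))
      (horizL m + (innerSL ℝ (flatGrad ε f g p t)).smulRight (vertE m)) p :=
  (horizL m).hasFDerivAt.add ((hasFDerivAt_flatX hf hg p t).smul_const (vertE m))

theorem hasDerivAt_flatMap {m : ℕ} (ε : ℝ) (f g : E m → ℝ) (p : E m) (t : ℝ) :
    HasDerivAt (fun t => flatMap ε f g (p, t)) (((ε + f p - g p) / (2*ε)) • vertE m) t :=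
  ((hasDerivAt_flatX ε f g p t).smul_const (vertE m)).const_add (horizL m p)

theorem hasDerivAt_flatGrad {m : ℕ} (ε : ℝ) (f g : E m → ℝ) (p : E m) (t : ℝ) :
    HasDerivAt (fun t => flatGrad ε f g p t) ((2*ε)⁻¹ • (gradient f p - gradient g p)) t := by
  have := ((((hasDerivAt_id t).add_const ε).div_const (2*ε)).smul_const
    (gradient f p - gradient g p)).const_add (gradient g p)
  simpa [flatGrad] using this

theorem C2Sigma.norm_gradient_le {k : ℕ} {c σ : ℝ} {f : E k → ℝ} (hf : C2Sigma c σ f)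
    (h0 : gradient f 0 = 0) (p : E k) : ‖gradient f p‖ ≤ c * ‖p‖ := by
  have := convex_univ.norm_image_sub_le_of_norm_fderiv_le (𝕜 := ℝ) (f := gradient f) (C := c)
    (fun x _ => (contDiffAt_gradient hf.1.contDiffAt).differentiableAt (by norm_num))
    (fun x _ => hf.2.2.2.1 x) (mem_univ (0 : E k)) (mem_univ p)
  simpa [h0] using this

theorem norm_flatGrad_le {m : ℕ} {ε : ℝ} (hε : 0 < ε) {f g : E m → ℝ} {p : E m} {B : ℝ}
    (hf : ‖gradient f p‖ ≤ B) (hg : ‖gradient g p‖ ≤ B) {t : ℝ} (ht : t ∈ Icc (-ε) ε) :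
    ‖flatGrad ε f g p t‖ ≤ B := by
  set θ := (t + ε) / (2*ε) with hθ
  have h0 : 0 ≤ θ := div_nonneg (by linarith [ht.1]) (by linarith)
  have h1 : θ ≤ 1 := by rw [hθ, div_le_one (by linarith)]; linarith [ht.2]
  have : flatGrad ε f g p t = (1 - θ) • gradient g p + θ • gradient f p := by
    rw [flatGrad, ← hθ]; module
  rw [this]
  refine (norm_add_le _ _).trans ?_
  rw [norm_smul, norm_smul, Real.norm_of_nonneg h0, Real.norm_of_nonneg (sub_nonneg.2 h1)]
  nlinarith [mul_le_mul_of_nonneg_left hf h0, mul_le_mul_of_nonneg_left hg (sub_nonneg.2 h1)]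

theorem gap_nonneg {m : ℕ} {μ K σ R0 : ℝ} (hK : 0 < K) (hσ : 0 < σ)
    (hμ : 0 < μ) (hKR0 : K * R0 ^ σ ≤ μ / 2) {f g : E m → ℝ} {p : E m} (hp : ‖p‖ < R0)
    (h : |f p - g p - μ * ‖p‖^2| ≤ K * ‖p‖ ^ ((2:ℝ) + σ)) : 0 ≤ f p - g p := by
  have h1 : ‖p‖ ^ σ ≤ R0 ^ σ := Real.rpow_le_rpow (norm_nonneg p) hp.le hσ.le
  have h2 : ‖p‖ ^ ((2:ℝ) + σ) = ‖p‖ ^ 2 * ‖p‖ ^ σ := by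
    rw [Real.rpow_add_of_nonneg (norm_nonneg p) (by norm_num) hσ.le, Real.rpow_two]
  rw [h2] at h
  have h3 := mul_le_mul_of_nonneg_left (mul_le_mul_of_nonneg_left h1 hK.le) (sq_nonneg ‖p‖)
  have h4 := mul_le_mul_of_nonneg_left hKR0 (sq_nonneg ‖p‖)
  have h5 := (abs_le.1 h).1
  nlinarith [mul_nonneg hμ.le (sq_nonneg ‖p‖)]

/-- The Robin condition on a boundary with (unnormalised) conormal `N` of slope `w`. -/
theorem robin_conormal {X : Type*} [NormedAddCommGroup X] [InnerProductSpace ℝ X]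
    [CompleteSpace X] {u : X → ℝ} {x N : X} {γ s : ℝ} (hγ : 0 < γ) (hs : 0 < s)
    (h : u x + γ * ⟪s⁻¹ • N, gradient u x⟫ = 0) : fderiv ℝ u x N = -(s * u x / γ) := by
  rw [real_inner_comm, inner_smul_right, gradient, InnerProductSpace.toDual_symm_apply] at h
  field_simp at h ⊢
  linarith

theorem sqrt_one_add_sq_bounds (a : ℝ) :
    1 ≤ Real.sqrt (1 + a^2) ∧ Real.sqrt (1 + a^2) ≤ 1 + a^2 / 2 := by
  constructor
  · rw [Real.le_sqrt' one_pos]; nlinarith [sq_nonneg a]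
  · rw [Real.sqrt_le_left (by positivity)]; nlinarith [sq_nonneg (a^2)]

/-- Deviation of a function from its mean over an interval. -/
theorem abs_sub_average_le {ε M : ℝ} (hε : 0 < ε) {φ : ℝ → ℝ}
    (hφ : ∀ t ∈ Icc (-ε) ε, DifferentiableAt ℝ φ t) (hM : ∀ t ∈ Icc (-ε) ε, |deriv φ t| ≤ M)
    {s : ℝ} (hs : s ∈ Icc (-ε) ε) :
    |φ s - (1/(2*ε)) * ∫ t in (-ε)..ε, φ t| ≤ 2 * ε * M := by
  have hab : -ε ≤ ε := by linarith
  have hM0 : 0 ≤ M := (abs_nonneg _).trans (hM s hs)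
  have hi : IntervalIntegrable φ volume (-ε) ε :=
    ContinuousOn.intervalIntegrable_of_Icc hab
      fun t ht => (hφ t ht).continuousAt.continuousWithinAt
  have h1 : φ s - (1/(2*ε)) * ∫ t in (-ε)..ε, φ t =
      (1/(2*ε)) * ∫ t in (-ε)..ε, (φ s - φ t) := by
    rw [intervalIntegral.integral_sub intervalIntegrable_const hi,
      intervalIntegral.integral_const, smul_eq_mul]
    field_simp
    ring
  have h2 : ‖∫ t in (-ε)..ε, (φ s - φ t)‖ ≤ 2 * ε * M * |ε - -ε| := by
    refine intervalIntegral.norm_integral_le_of_norm_le_const fun t ht => ?_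
    rw [uIoc_of_le hab] at ht
    have ht' := Ioc_subset_Icc_self ht
    refine ((convex_Icc (-ε) ε).norm_image_sub_le_of_norm_deriv_le hφ hM ht' hs).trans ?_
    rw [mul_comm]
    refine mul_le_mul_of_nonneg_right (abs_le.2 ⟨?_, ?_⟩) hM0 <;>
      linarith [hs.1, hs.2, ht'.1, ht'.2]
  rw [show |ε - -ε| = 2 * ε by rw [abs_of_pos] <;> linarith, Real.norm_eq_abs] at h2
  rw [h1, abs_mul, abs_of_pos (by positivity), one_div, inv_mul_le_iff₀ (by positivity)]
  linarith

section Neck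
variable {m : ℕ} {ε R0 : ℝ} {f g : E m → ℝ} {u : E (m+1) → ℝ}

theorem contDiffAt_flatV (hε : 0 < ε) (hf : ContDiff ℝ 2 f) (hg : ContDiff ℝ 2 g)
    (hfg : ∀ p ∈ ball (0 : E m) R0, 0 ≤ f p - g p)
    (hu : ∀ x ∈ regio ε R0 f g, ContDiffAt ℝ 2 u x) {p : E m} (hp : p ∈ ball (0 : E m) R0)
    {t : ℝ} (ht : t ∈ Icc (-ε) ε) : ContDiffAt ℝ 2 (fun x => u (flatMap ε f g x)) (p, t) :=
  (hu _ (flatMap_mem_regio hε hp (hfg p hp) ht)).comp (p, t) (contDiff_flatMap hf hg).contDiffAt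

theorem contDiffAt_fderiv_flatMap (hε : 0 < ε) (hf : ContDiff ℝ 2 f) (hg : ContDiff ℝ 2 g)
    (hfg : ∀ p ∈ ball (0 : E m) R0, 0 ≤ f p - g p)
    (hu : ∀ x ∈ regio ε R0 f g, ContDiffAt ℝ 2 u x) {p : E m} (hp : p ∈ ball (0 : E m) R0)
    {t : ℝ} (ht : t ∈ Icc (-ε) ε) :
    ContDiffAt ℝ 1 (fun x => fderiv ℝ u (flatMap ε f g x)) (p, t) :=
  ((hu _ (flatMap_mem_regio hε hp (hfg p hp) ht)).fderiv_right (m := 1) (by norm_num)).comp (p, t)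
    ((contDiff_flatMap hf hg).contDiffAt.of_le (by norm_num))

theorem contDiffAt_flux (hε : 0 < ε) (hf : ContDiff ℝ 2 f) (hg : ContDiff ℝ 2 g)
    (hfg : ∀ p ∈ ball (0 : E m) R0, 0 ≤ f p - g p)
    (hu : ∀ x ∈ regio ε R0 f g, ContDiffAt ℝ 2 u x) {p : E m} (hp : p ∈ ball (0 : E m) R0)
    {t : ℝ} (ht : t ∈ Icc (-ε) ε) :
    ContDiffAt ℝ 1 (fun x : E m × ℝ => ((ε + f x.1 - g x.1) / (2*ε)) •
      dualComp (horizL m) (fderiv ℝ u (flatMap ε f g x))) (p, t) := by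
  have h1 := (dualComp (horizL m)).contDiff.contDiffAt.comp (p, t)
    (contDiffAt_fderiv_flatMap hε hf hg hfg hu hp ht)
  have h2 : ContDiff ℝ 1 (fun x : E m × ℝ => (ε + f x.1 - g x.1) / (2*ε)) := by
    have := hf.of_le (show (1 : WithTop ℕ∞) ≤ 2 by norm_num)
    have := hg.of_le (show (1 : WithTop ℕ∞) ≤ 2 by norm_num)
    fun_prop
  exact h2.contDiffAt.smul h1

theorem vbar_eq (ε : ℝ) (f g : E m → ℝ) (u : E (m+1) → ℝ) :
    vbar ε f g u = fun p => (1/(2*ε)) * ∫ t in (-ε)..ε, u (flatMap ε f g (p, t)) := by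
  funext p
  simp only [vbar, flatV_eq]

theorem contDiffAt_vbar (hε : 0 < ε) (hf : ContDiff ℝ 2 f) (hg : ContDiff ℝ 2 g)
    (hfg : ∀ p ∈ ball (0 : E m) R0, 0 ≤ f p - g p)
    (hu : ∀ x ∈ regio ε R0 f g, ContDiffAt ℝ 2 u x) {p : E m} (hp : p ∈ ball (0 : E m) R0) :
    ContDiffAt ℝ 2 (vbar ε f g u) p := by
  have hV := fun p hp t ht => contDiffAt_flatV hε hf hg hfg hu (p := p) hp (t := t) ht
  have hd := fun p hp => hasFDerivAt_parametric_intervalIntegral (by linarith) isOpen_ball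
    (fun p hp t ht => (hV p hp t ht).of_le (by norm_num)) (p := p) hp
  have : ContDiffOn ℝ (1 + 1) (fun p => ∫ t in (-ε)..ε, u (flatMap ε f g (p, t)))
      (ball (0 : E m) R0) := by
    rw [contDiffOn_succ_iff_fderiv_of_isOpen isOpen_ball]
    refine ⟨fun p hp => (hd p hp).differentiableAt.differentiableWithinAt, by simp, ?_⟩
    refine ContDiffOn.congr (contDiffOn_one_parametric_intervalIntegral (a := -ε) (b := ε)
      (by linarith) isOpen_ball (φ := fun x => (fderiv ℝ (fun x => u (flatMap ε f g x)) x).comp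
        (ContinuousLinearMap.inl ℝ (E m) ℝ)) fun p hp t ht => ?_) fun p hp => (hd p hp).fderiv
    exact ((hV p hp t ht).fderiv_right (m := 1) (by norm_num)).clm_comp contDiffAt_const
  rw [vbar_eq]
  exact contDiffAt_const.mul ((this.contDiffAt (isOpen_ball.mem_nhds hp)).of_le (by norm_num))

theorem hasDerivAt_flatV (hε : 0 < ε) (hfg : ∀ p ∈ ball (0 : E m) R0, 0 ≤ f p - g p)
    (hu : ∀ x ∈ regio ε R0 f g, ContDiffAt ℝ 2 u x) {p : E m} (hp : p ∈ ball (0 : E m) R0)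
    {t : ℝ} (ht : t ∈ Icc (-ε) ε) :
    HasDerivAt (flatV ε f g u p)
      ((ε + f p - g p) / (2*ε) * fderiv ℝ u (flatMap ε f g (p, t)) (vertE m)) t := by
  have h := ((hu _ (flatMap_mem_regio hε hp (hfg p hp) ht)).differentiableAt
    (by norm_num)).hasFDerivAt.comp_hasDerivAt t (hasDerivAt_flatMap ε f g p t)
  rw [map_smul, smul_eq_mul] at h
  rwa [show flatV ε f g u p = u ∘ fun t => flatMap ε f g (p, t) from funext (flatV_eq ε f g u p)]

theorem continuousOn_deriv_flatV (hε : 0 < ε) (hf : ContDiff ℝ 2 f) (hg : ContDiff ℝ 2 g)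
    (hfg : ∀ p ∈ ball (0 : E m) R0, 0 ≤ f p - g p)
    (hu : ∀ x ∈ regio ε R0 f g, ContDiffAt ℝ 2 u x) {p : E m} (hp : p ∈ ball (0 : E m) R0) :
    ContinuousOn (deriv (flatV ε f g u p)) (Icc (-ε) ε) := by
  refine ContinuousOn.congr ?_ fun t ht => (hasDerivAt_flatV hε hfg hu hp ht).deriv
  refine continuousOn_const.mul (ContinuousOn.clm_apply ?_ continuousOn_const)
  exact continuousOn_slice (V := ball (0 : E m) R0)
    (φ := fun x => fderiv ℝ u (flatMap ε f g x)) (fun p hp t ht =>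
    (contDiffAt_fderiv_flatMap hε hf hg hfg hu hp ht).continuousAt) hp

theorem continuous_flatGrad (ε : ℝ) (f g : E m → ℝ) (p : E m) :
    Continuous (flatGrad ε f g p) := by
  unfold flatGrad
  fun_prop

theorem gap_smul_gradient_vbar (hε : 0 < ε) (hf : ContDiff ℝ 2 f) (hg : ContDiff ℝ 2 g)
    (hfg : ∀ p ∈ ball (0 : E m) R0, 0 ≤ f p - g p)
    (hu : ∀ x ∈ regio ε R0 f g, ContDiffAt ℝ 2 u x) {p : E m} (hp : p ∈ ball (0 : E m) R0) :
    (ε + f p - g p) • gradient (vbar ε f g u) p = sliceFlux ε f g u p +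
      ∫ t in (-ε)..ε, deriv (flatV ε f g u p) t • flatGrad ε f g p t := by
  have hab : -ε ≤ ε := by linarith
  have hV : ∀ p ∈ ball (0 : E m) R0, ∀ t ∈ Icc (-ε) ε,
      ContDiffAt ℝ 1 (fun x => u (flatMap ε f g x)) (p, t) := fun p hp t ht =>
    (contDiffAt_flatV hε hf hg hfg hu hp ht).of_le (by norm_num)
  obtain ⟨hc, hd⟩ := hasFDerivAt_intervalIntegral_of_slice hab isOpen_ball hV hp
    (A := fun t => (fderiv ℝ u (flatMap ε f g (p, t))).comp
      (horizL m + (innerSL ℝ (flatGrad ε f g p t)).smulRight (vertE m))) fun t ht =>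
    ((hu _ (flatMap_mem_regio hε hp (hfg p hp) ht)).differentiableAt
      (by norm_num)).hasFDerivAt.comp p (hasFDerivAt_flatMap hf hg p t)
  have hd' := hd.const_mul (1/(2*ε))
  have hcQ : ContinuousOn (fun t => ((ε + f p - g p) / (2*ε)) •
      dualComp (horizL m) (fderiv ℝ u (flatMap ε f g (p, t)))) (Icc (-ε) ε) :=
    continuousOn_slice (V := ball (0 : E m) R0) (φ := fun x : E m × ℝ =>
      ((ε + f x.1 - g x.1) / (2*ε)) • dualComp (horizL m) (fderiv ℝ u (flatMap ε f g x)))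
      (fun p hp t ht => (contDiffAt_flux hε hf hg hfg hu hp ht).continuousAt) hp
  have hcN : ContinuousOn (fun t => deriv (flatV ε f g u p) t • flatGrad ε f g p t)
      (Icc (-ε) ε) :=
    (continuousOn_deriv_flatV hε hf hg hfg hu hp).smul (continuous_flatGrad ε f g p).continuousOn
  have iA := hc.intervalIntegrable_of_Icc (μ := volume) hab
  have iQ := hcQ.intervalIntegrable_of_Icc (μ := volume) hab
  have iN := hcN.intervalIntegrable_of_Icc (μ := volume) hab
  rw [sliceFlux, ← intervalIntegral.integral_add iQ iN]
  refine ext_inner_left ℝ fun a => ?_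
  rw [inner_smul_right, real_inner_comm, inner_gradient_eq_fderiv, vbar_eq, hd'.fderiv,
    ← innerSL_apply_apply (𝕜 := ℝ) a,
    ← ContinuousLinearMap.intervalIntegral_comp_comm _ (iQ.add iN),
    smul_apply, ContinuousLinearMap.intervalIntegral_apply iA, smul_eq_mul,
    ← mul_assoc, ← intervalIntegral.integral_const_mul]
  refine intervalIntegral.integral_congr fun t ht => ?_
  rw [uIcc_of_le hab] at ht
  simp only [(hasDerivAt_flatV hε hfg hu hp ht).deriv, innerSL_apply_apply,
    real_inner_comm _ a]
  simp [inner_add_left, inner_smul_left, inner_dualComp]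
  ring

theorem contDiffOn_sliceFlux (hε : 0 < ε) (hf : ContDiff ℝ 2 f) (hg : ContDiff ℝ 2 g)
    (hfg : ∀ p ∈ ball (0 : E m) R0, 0 ≤ f p - g p)
    (hu : ∀ x ∈ regio ε R0 f g, ContDiffAt ℝ 2 u x) :
    ContDiffOn ℝ 1 (sliceFlux ε f g u) (ball (0 : E m) R0) :=
  contDiffOn_one_parametric_intervalIntegral (by linarith) isOpen_ball
    (φ := fun x : E m × ℝ => ((ε + f x.1 - g x.1) / (2*ε)) •
      dualComp (horizL m) (fderiv ℝ u (flatMap ε f g x)))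
    fun _ hp _ ht => contDiffAt_flux hε hf hg hfg hu hp ht

set_option maxHeartbeats 1000000 in
theorem divg_sliceFlux (hε : 0 < ε) (hf : ContDiff ℝ 2 f) (hg : ContDiff ℝ 2 g)
    (hfg : ∀ p ∈ ball (0 : E m) R0, 0 ≤ f p - g p)
    (hu : ∀ x ∈ regio ε R0 f g, ContDiffAt ℝ 2 u x)
    (hharm : ∀ x ∈ neck ε f g 0 R0, elap u x = 0) {p : E m} (hp : p ∈ ball (0 : E m) R0) :
    divg (sliceFlux ε f g u) p =
      fderiv ℝ u (eglue p (ε/2 + f p)) (horizL m (gradient f p) - vertE m) -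
      fderiv ℝ u (eglue p (-(ε/2) + g p)) (horizL m (gradient g p) - vertE m) := by
  have hab : -ε ≤ ε := by linarith
  have hu1 : ∀ t ∈ Icc (-ε) ε, HasFDerivAt (fderiv ℝ u)
      (fderiv ℝ (fderiv ℝ u) (flatMap ε f g (p, t))) (flatMap ε f g (p, t)) := fun t ht =>
    (((hu _ (flatMap_mem_regio hε hp (hfg p hp) ht)).fderiv_right (m := 1)
      (by norm_num)).differentiableAt (by norm_num)).hasFDerivAt
  set η : E m := (2*ε)⁻¹ • (gradient f p - gradient g p) with hη
  have hs : HasFDerivAt (fun q => (ε + f q - g q) / (2*ε)) (innerSL ℝ η) p := by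
    have h1 := ((hf.differentiable (by norm_num)) p).hasFDerivAt
    have h2 := ((hg.differentiable (by norm_num)) p).hasFDerivAt
    refine (((h1.const_add ε).sub h2).mul_const (2*ε)⁻¹).congr_fderiv ?_
    ext a
    simp [hη]
  have hA : ∀ t ∈ Icc (-ε) ε, HasFDerivAt (fun q => ((ε + f q - g q) / (2*ε)) •
      dualComp (horizL m) (fderiv ℝ u (flatMap ε f g (q, t)))) _ p := fun t ht =>
    hs.smul ((dualComp (horizL m)).hasFDerivAt.comp p
      (HasFDerivAt.comp (f := fun q => flatMap ε f g (q, t)) p (hu1 t ht)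
        (hasFDerivAt_flatMap hf hg p t)))
  obtain ⟨hc, hd⟩ := hasFDerivAt_intervalIntegral_of_slice hab isOpen_ball
    (φ := fun x : E m × ℝ => ((ε + f x.1 - g x.1) / (2*ε)) •
      dualComp (horizL m) (fderiv ℝ u (flatMap ε f g x)))
    (fun p hp t ht => contDiffAt_flux hε hf hg hfg hu hp ht) hp hA
  have iA := hc.intervalIntegrable_of_Icc (μ := volume) hab
  have hZ : ∀ t ∈ Icc (-ε) ε, HasDerivAt (fun t => fderiv ℝ u (flatMap ε f g (p, t))
      (horizL m (flatGrad ε f g p t) - vertE m)) _ t := fun t ht =>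
    ((hu1 t ht).comp_hasDerivAt t (hasDerivAt_flatMap ε f g p t)).clm_apply
      (((horizL m).hasFDerivAt.comp_hasDerivAt t
        (hasDerivAt_flatGrad ε f g p t)).sub_const (vertE m))
  have hd' : HasFDerivAt (sliceFlux ε f g u) _ p := hd
  rw [divg_eq_traceL, hd'.fderiv,
    ← ContinuousLinearMap.intervalIntegral_comp_comm _ iA]
  rw [intervalIntegral.integral_eq_sub_of_hasDerivAt_of_le hab
    (f := fun t => fderiv ℝ u (flatMap ε f g (p, t))
      (horizL m (flatGrad ε f g p t) - vertE m))
    (fun t ht => (hZ t ht).continuousAt.continuousWithinAt)]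
  · simp only [flatMap_eq_eglue, flatX_top hε, flatX_bot, flatGrad_top hε, flatGrad_bot]
  · intro t ht
    have ht' := Ioo_subset_Icc_self ht
    refine (hZ t ht').congr_deriv ?_
    have hl := hharm _ (flatMap_mem_neck hε hp (hfg p hp) ht)
    rw [elap_succ_eq] at hl
    set D := fderiv ℝ (fderiv ℝ u) (flatMap ε f g (p, t)) with hD
    have h1 : ∑ i, flatGrad ε f g p t i * D (vertE m) (horizL m (EuclideanSpace.single i 1)) =
        D (vertE m) (horizL m (flatGrad ε f g p t)) :=
      sum_mul_apply_single ((D (vertE m)).comp (horizL m)) _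
    rw [map_add, traceL_smulRight, innerSL_apply_apply, real_inner_comm, inner_dualComp,
      map_smul, traceL_apply]
    simp only [ContinuousLinearMap.comp_apply, add_apply, ContinuousLinearMap.smulRight_apply,
      innerSL_apply_apply, map_add, map_smul, dualComp_coord, smul_apply, smul_eq_mul, map_sub,
      EuclideanSpace.inner_single_right, one_mul, conj_trivial, PiLp.add_apply, PiLp.smul_apply,
      ← Finset.mul_sum, Finset.sum_add_distrib, h1, hη]
    linear_combination (-(ε + f p - g p) / (2*ε)) * hl
  · exact ((traceL m).continuous.comp_continuousOn hc).intervalIntegrable_of_Icc hab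

theorem norm_integral_deriv_smul_flatGrad_le (hε : 0 < ε) (hf : ContDiff ℝ 2 f)
    (hg : ContDiff ℝ 2 g) (hfg : ∀ p ∈ ball (0 : E m) R0, 0 ≤ f p - g p)
    (hu : ∀ x ∈ regio ε R0 f g, ContDiffAt ℝ 2 u x) {p : E m} (hp : p ∈ ball (0 : E m) R0)
    {B : ℝ} (hfB : ‖gradient f p‖ ≤ B) (hgB : ‖gradient g p‖ ≤ B) :
    ‖∫ t in (-ε)..ε, deriv (flatV ε f g u p) t • flatGrad ε f g p t‖ ≤
      B * ∫ t in (-ε)..ε, |deriv (flatV ε f g u p) t| := by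
  have hab : -ε ≤ ε := by linarith
  rw [← intervalIntegral.integral_const_mul]
  refine intervalIntegral.norm_integral_le_of_norm_le hab (.of_forall fun t ht => ?_)
    (((continuousOn_deriv_flatV hε hf hg hfg hu hp).abs.intervalIntegrable_of_Icc
      hab).const_mul B)
  rw [norm_smul, mul_comm, Real.norm_eq_abs]
  exact mul_le_mul_of_nonneg_right (norm_flatGrad_le hε hfB hgB (Ioc_subset_Icc_self ht))
    (abs_nonneg _)

theorem divg_sliceFlux_of_robin {γ : ℝ} (hγ : 0 < γ) (hε : 0 < ε) (hf : ContDiff ℝ 2 f)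
    (hg : ContDiff ℝ 2 g) (hfg : ∀ p ∈ ball (0 : E m) R0, 0 ≤ f p - g p)
    (hu : ∀ x ∈ regio ε R0 f g, ContDiffAt ℝ 2 u x)
    (hharm : ∀ x ∈ neck ε f g 0 R0, elap u x = 0) {p : E m} (hp : p ∈ ball (0 : E m) R0)
    (htop : u (eglue p (ε/2 + f p)) + γ * ⟪nuP f p, gradient u (eglue p (ε/2 + f p))⟫ = 0)
    (hbot : u (eglue p (-(ε/2) + g p)) +
      γ * ⟪nuM g p, gradient u (eglue p (-(ε/2) + g p))⟫ = 0) :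
    divg (sliceFlux ε f g u) p = (Real.sqrt (1 + ‖gradient f p‖^2) * flatV ε f g u p ε +
      Real.sqrt (1 + ‖gradient g p‖^2) * flatV ε f g u p (-ε)) / γ := by
  have hs := fun a : ℝ => one_pos.trans_le (sqrt_one_add_sq_bounds a).1
  have h1 := robin_conormal hγ (hs _) htop
  have h2 := robin_conormal hγ (hs _) hbot
  rw [eglue_eq (-gradient f p), map_neg, one_smul] at h1
  rw [eglue_eq (gradient g p), neg_one_smul, ← sub_eq_add_neg] at h2
  rw [divg_sliceFlux hε hf hg hfg hu hharm hp, h2, flatV_eq, flatV_eq, flatMap_eq_eglue,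
    flatMap_eq_eglue, flatX_top hε, flatX_bot, sub_neg_eq_add,
    ← neg_sub (vertE m), map_neg, ← neg_add_eq_sub, h1]
  ring

theorem abs_robin_source_le {γ c : ℝ} (hγ : 0 < γ) (hε : 0 < ε)
    (hf : ContDiff ℝ 2 f) (hg : ContDiff ℝ 2 g)
    (hfg : ∀ p ∈ ball (0 : E m) R0, 0 ≤ f p - g p)
    (hu : ∀ x ∈ regio ε R0 f g, ContDiffAt ℝ 2 u x) {p : E m} (hp : p ∈ ball (0 : E m) R0)
    (hfB : ‖gradient f p‖ ≤ c * ‖p‖) (hgB : ‖gradient g p‖ ≤ c * ‖p‖) :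
    |(Real.sqrt (1 + ‖gradient f p‖^2) * flatV ε f g u p ε +
      Real.sqrt (1 + ‖gradient g p‖^2) * flatV ε f g u p (-ε)) / γ
      - (2/γ) * vbar ε f g u p| ≤ (2 * c^2 * R0^2 + 4 + c^2) / γ *
      (ε * sSup ((fun t => |deriv (flatV ε f g u p) t|) '' Icc (-ε) ε)
        + ‖p‖^2 * |vbar ε f g u p|) := by
  set M := sSup ((fun t => |deriv (flatV ε f g u p) t|) '' Icc (-ε) ε) with hMdef
  have hbdd : BddAbove ((fun t => |deriv (flatV ε f g u p) t|) '' Icc (-ε) ε) :=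
    (isCompact_Icc.image_of_continuousOn (continuousOn_deriv_flatV hε hf hg hfg hu hp).abs).bddAbove
  have hM : ∀ t ∈ Icc (-ε) ε, |deriv (flatV ε f g u p) t| ≤ M := fun t ht =>
    le_csSup hbdd ⟨t, ht, rfl⟩
  have hd : ∀ t ∈ Icc (-ε) ε, DifferentiableAt ℝ (flatV ε f g u p) t := fun t ht =>
    (hasDerivAt_flatV hε hfg hu hp ht).differentiableAt
  have htop : ε ∈ Icc (-ε) ε := ⟨by linarith, le_rfl⟩
  have hbot : -ε ∈ Icc (-ε) ε := ⟨le_rfl, by linarith⟩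
  have hM0 : 0 ≤ M := (abs_nonneg _).trans (hM ε htop)
  have key : ∀ (s : ℝ) (w : E m), s ∈ Icc (-ε) ε → ‖w‖ ≤ c * ‖p‖ →
      |Real.sqrt (1 + ‖w‖^2) * flatV ε f g u p s - vbar ε f g u p| ≤
      c^2 * ‖p‖^2 / 2 * (|vbar ε f g u p| + 2 * ε * M) + 2 * ε * M := by
    intro s w hs hw
    have h1 : |flatV ε f g u p s - vbar ε f g u p| ≤ 2 * ε * M := abs_sub_average_le hε hd hM hs
    obtain ⟨h2, h3⟩ := sqrt_one_add_sq_bounds ‖w‖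
    have h4 : Real.sqrt (1 + ‖w‖^2) - 1 ≤ c^2 * ‖p‖^2 / 2 := by
      have := pow_le_pow_left₀ (norm_nonneg w) hw 2
      rw [mul_pow] at this
      linarith
    have h5 : |flatV ε f g u p s| ≤ |vbar ε f g u p| + 2 * ε * M := by
      have := abs_add_le (flatV ε f g u p s - vbar ε f g u p) (vbar ε f g u p)
      rw [sub_add_cancel] at this
      linarith
    calc |Real.sqrt (1 + ‖w‖^2) * flatV ε f g u p s - vbar ε f g u p|
        = |(Real.sqrt (1 + ‖w‖^2) - 1) * flatV ε f g u p s +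
            (flatV ε f g u p s - vbar ε f g u p)| := by congr 1; ring
      _ ≤ |(Real.sqrt (1 + ‖w‖^2) - 1) * flatV ε f g u p s| +
            |flatV ε f g u p s - vbar ε f g u p| := abs_add_le _ _
      _ ≤ _ := by
        rw [abs_mul, abs_of_nonneg (sub_nonneg.2 h2)]
        exact add_le_add (mul_le_mul h4 h5 (abs_nonneg _) (by positivity)) h1
  have k1 := key ε _ htop hfB
  have k2 := key (-ε) _ hbot hgB
  have hpR : ‖p‖^2 ≤ R0^2 :=
    pow_le_pow_left₀ (norm_nonneg p) (mem_ball_zero_iff.1 hp).le 2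
  have h6 := (abs_add_le _ _).trans (add_le_add k1 k2)
  have h7 : c^2 * ‖p‖^2 * (2 * ε * M) ≤ c^2 * R0^2 * (2 * ε * M) :=
    mul_le_mul_of_nonneg_right (mul_le_mul_of_nonneg_left hpR (sq_nonneg c)) (by positivity)
  have e1 : (Real.sqrt (1 + ‖gradient f p‖^2) * flatV ε f g u p ε +
      Real.sqrt (1 + ‖gradient g p‖^2) * flatV ε f g u p (-ε)) / γ - (2/γ) * vbar ε f g u p =
      (Real.sqrt (1 + ‖gradient f p‖^2) * flatV ε f g u p ε - vbar ε f g u p +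
      (Real.sqrt (1 + ‖gradient g p‖^2) * flatV ε f g u p (-ε) - vbar ε f g u p)) / γ := by
    ring
  rw [e1, abs_div, abs_of_pos hγ, div_mul_eq_mul_div, div_le_div_iff_of_pos_right hγ]
  have h8 : 0 ≤ (2 * c^2 * R0^2 + 4) * (‖p‖^2 * |vbar ε f g u p|) := by positivity
  have h9 : 0 ≤ c^2 * (ε * M) := by positivity
  linarith

end Neck

/-- Lemma 5.1 (dimension reduction): the vertical average `v̄` satisfies
`(ε+μ|y'|²)Δv̄ + 2μ⟨y',∇v̄⟩ - (2/γ)v̄ = div F + G` with the stated bounds on `F`, `G`. -/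
theorem dimension_reduction (m : ℕ) (hm : 1 ≤ m) (γ μ K c3 σ R0 : ℝ)
    (hγ : 0 < γ) (hμ : 0 < μ) (hK : 0 < K) (hc3 : 0 < c3) (hσ : σ ∈ Set.Ioo (0:ℝ) 1)
    (hR0 : 0 < R0) (hKR0 : K * R0 ^ σ ≤ μ / 2) :
    ∃ C : ℝ, 0 < C ∧
      ∀ ε ∈ Set.Ioo (0:ℝ) (R0/4), ∀ f g : E m → ℝ,
      C2Sigma c3 σ f → C2Sigma c3 σ g →
      f 0 = 0 → g 0 = 0 → gradient f 0 = 0 → gradient g 0 = 0 →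
      (∀ p : E m, ‖p‖ < R0 → |f p - g p - μ * ‖p‖^2| ≤ K * ‖p‖ ^ ((2:ℝ) + σ)) →
      ∀ u : E (m+1) → ℝ,
      (∀ x ∈ regio ε R0 f g, ContDiffAt ℝ 2 u x) →
      (∀ x ∈ neck ε f g 0 R0, elap u x = 0) →
      (∀ p ∈ ball (0 : E m) R0,
        u (eglue p (ε/2 + f p)) + γ * ⟪nuP f p, gradient u (eglue p (ε/2 + f p))⟫ = 0) →
      (∀ p ∈ ball (0 : E m) R0,
        u (eglue p (-(ε/2) + g p)) + γ * ⟪nuM g p, gradient u (eglue p (-(ε/2) + g p))⟫ = 0) →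
      ∃ F : E m → E m, ∃ G : E m → ℝ,
        ContDiffOn ℝ 1 F (ball (0 : E m) R0) ∧
        ContinuousOn G (ball (0 : E m) R0) ∧
        ∀ y ∈ ball (0 : E m) R0,
          ((ε + μ * ‖y‖^2) * elap (vbar ε f g u) y
              + 2 * μ * ⟪y, gradient (vbar ε f g u) y⟫
              - (2/γ) * vbar ε f g u y = divg F y + G y) ∧
          (‖F y‖ ≤ C * (ε * ‖y‖ * ((1/(2*ε)) * ∫ t in (-ε)..ε, |deriv (flatV ε f g u y) t|)
              + |f y - g y - μ * ‖y‖^2| * ‖gradient (vbar ε f g u) y‖)) ∧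
          (|G y| ≤ C * (ε * sSup ((fun t => |deriv (flatV ε f g u y) t|) '' Set.Icc (-ε) ε)
              + ‖y‖^2 * |vbar ε f g u y|)) := by

  have hC : 0 ≤ (2 * c3^2 * R0^2 + 4 + c3^2) / γ := by positivity
  refine ⟨(2 * c3^2 * R0^2 + 4 + c3^2) / γ + 2 * c3 + 1, by positivity, ?_⟩
  rintro ε ⟨hε, -⟩ f g hf hg - - hf0 hg0 hgap u hu hharm htop hbot
  have hfg : ∀ p ∈ ball (0 : E m) R0, 0 ≤ f p - g p := fun p hp =>
    gap_nonneg hK hσ.1 hμ hKR0 (mem_ball_zero_iff.1 hp) (hgap p (mem_ball_zero_iff.1 hp))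
  have hfB := hf.norm_gradient_le hf0
  have hgB := hg.norm_gradient_le hg0
  have hW := contDiffOn_sliceFlux hε hf.1 hg.1 hfg hu
  have hv := fun p hp => contDiffAt_vbar hε hf.1 hg.1 hfg hu (p := p) hp
  have hw : ContDiff ℝ 1 (fun y : E m => ε + μ * ‖y‖^2) :=
    contDiff_const.add (contDiff_const.mul (contDiff_norm_sq ℝ))
  have hA : ∀ y ∈ ball (0 : E m) R0,
      ContDiffAt ℝ 1 (fun y => (ε + μ * ‖y‖^2) • gradient (vbar ε f g u) y) y := fun y hy =>
    hw.contDiffAt.smul (contDiffAt_gradient (hv y hy))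
  refine ⟨fun y => (ε + μ * ‖y‖^2) • gradient (vbar ε f g u) y - sliceFlux ε f g u y,
    fun y => divg (sliceFlux ε f g u) y - (2/γ) * vbar ε f g u y,
    ContDiffOn.sub (fun y hy => (hA y hy).contDiffWithinAt) hW, ?_, fun y hy => ⟨?_, ?_, ?_⟩⟩
  · refine ContinuousOn.sub ?_ (continuousOn_const.mul
      fun y hy => (hv y hy).continuousAt.continuousWithinAt)
    simp only [funext (divg_eq_traceL (sliceFlux ε f g u))]
    exact (traceL m).continuous.comp_continuousOn
      (hW.continuousOn_fderiv_of_isOpen isOpen_ball le_rfl)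
  · have hw' : fderiv ℝ (fun y : E m => ε + μ * ‖y‖^2) y (gradient (vbar ε f g u) y) =
        2 * μ * ⟪y, gradient (vbar ε f g u) y⟫ := by
      rw [(((hasStrictFDerivAt_norm_sq y).hasFDerivAt.const_mul μ).const_add ε).fderiv]
      simp
      ring
    rw [divg_sub ((hA y hy).differentiableAt (by norm_num))
      ((hW.contDiffAt (isOpen_ball.mem_nhds hy)).differentiableAt (by norm_num)),
      divg_smul (hw.differentiable (by norm_num) y)
        ((contDiffAt_gradient (hv y hy)).differentiableAt (by norm_num)),
      divg_gradient (hv y hy), hw']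
    ring
  · have hF : (ε + μ * ‖y‖^2) • gradient (vbar ε f g u) y - sliceFlux ε f g u y =
        (∫ t in (-ε)..ε, deriv (flatV ε f g u y) t • flatGrad ε f g y t) -
          (f y - g y - μ * ‖y‖^2) • gradient (vbar ε f g u) y := by
      have h := gap_smul_gradient_vbar hε hf.1 hg.1 hfg hu hy
      rw [← sub_eq_iff_eq_add'] at h
      rw [← h]
      module
    simp only [hF]
    have h1 := norm_integral_deriv_smul_flatGrad_le hε hf.1 hg.1 hfg hu hy (hfB y) (hgB y)
    refine (norm_sub_le _ _).trans ?_
    rw [norm_smul, Real.norm_eq_abs]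
    have h2 : 0 ≤ ∫ t in (-ε)..ε, |deriv (flatV ε f g u y) t| :=
      intervalIntegral.integral_nonneg (by linarith) fun t _ => abs_nonneg _
    set I := ∫ t in (-ε)..ε, |deriv (flatV ε f g u y) t|
    have h3 : ε * ‖y‖ * ((1/(2*ε)) * I) = ‖y‖ * I / 2 := by field_simp
    rw [h3]
    have h4 : 0 ≤ ‖y‖ * I := by positivity
    have h5 : 0 ≤ |f y - g y - μ * ‖y‖^2| * ‖gradient (vbar ε f g u) y‖ := by positivity
    generalize |f y - g y - μ * ‖y‖^2| * ‖gradient (vbar ε f g u) y‖ = e at *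
    nlinarith [mul_nonneg hC h4, mul_nonneg hC h5, mul_nonneg hc3.le h5]
  · have h := abs_robin_source_le hγ hε hf.1 hg.1 hfg hu hy (hfB y) (hgB y)
    rw [← divg_sliceFlux_of_robin hγ hε hf.1 hg.1 hfg hu hharm hy (htop y hy) (hbot y hy)] at h
    refine h.trans (mul_le_mul_of_nonneg_right (by linarith) ?_)
    have : 0 ≤ sSup ((fun t => |deriv (flatV ε f g u y) t|) '' Icc (-ε) ε) :=
      Real.sSup_nonneg (by rintro _ ⟨t, -, rfl⟩; exact abs_nonneg _)
    positivity
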